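/- arXiv:0901.2983 — 8 statements merged into one kernel-verified Lean document; each statement's English description precedes it below -/
import Mathlib

section
/- Let A be an associative algebra over ℂ and Δ : A → A a ℂ-linear map satisfying Δ(p) = Δ(p)p + pΔ(p) for every idempotent p ∈ A. If p₁, …, pₙ are pairwise orthogonal idempotents in A (pᵢ pⱼ = 0 for i ≠ j), α₁, …, αₙ ∈ ℂ, and x = Σᵢ αᵢ pᵢ, then Δ(x²) = Δ(x)x + xΔ(x). -/
/-- Polarization of the idempotent identity along two orthogonal idempotents. -/
theorem jordan_cross_terms_eq_zero {A : Type*} [Ring A] [Algebra ℂ A] (Δ : A →ₗ[ℂ] A)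
    (h : ∀ p : A, p * p = p → Δ p = Δ p * p + p * Δ p) {p q : A}
    (hp : p * p = p) (hq : q * q = q) (hpq : p * q = 0) (hqp : q * p = 0) :
    (Δ p * q + q * Δ p) + (Δ q * p + p * Δ q) = 0 := by
  have key := h (p + q) (by simp [mul_add, add_mul, hp, hq, hpq, hqp])
  rw [map_add] at key
  calc (Δ p * q + q * Δ p) + (Δ q * p + p * Δ q)
      = ((Δ p + Δ q) * (p + q) + (p + q) * (Δ p + Δ q))
          - (Δ p * p + p * Δ p) - (Δ q * q + q * Δ q) := by noncomm_ring
    _ = 0 := by rw [← key, ← h p hp, ← h q hq]; abel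

/-- A ℂ-linear map Δ on a ℂ-algebra satisfying
Δ(p) = Δ(p)p + pΔ(p) for every idempotent p satisfies the Jordan identity
on linear combinations of pairwise orthogonal idempotents. -/
theorem jordan_identity_on_orthogonal_idempotent_combinations
    {A : Type*} [Ring A] [Algebra ℂ A] (Δ : A →ₗ[ℂ] A)
    (h : ∀ p : A, p * p = p → Δ p = Δ p * p + p * Δ p)
    (n : ℕ) (p : Fin n → A) (α : Fin n → ℂ)
    (hidem : ∀ i, p i * p i = p i)
    (horth : ∀ i j, i ≠ j → p i * p j = 0)
    (x : A) (hx : x = ∑ i, α i • p i) :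
    Δ (x * x) = Δ x * x + x * Δ x := by
  have hsq : x * x = ∑ i, (α i * α i) • p i := by
    rw [hx, Finset.sum_mul_sum]
    refine Finset.sum_congr rfl fun i _ => ?_
    rw [Finset.sum_eq_single i]
    · rw [smul_mul_smul_comm, hidem]
    · intro j _ hj
      rw [smul_mul_smul_comm, horth i j hj.symm, smul_zero]
    · simp
  have hexp : Δ x * x + x * Δ x =
      ∑ i, ∑ j, (α i * α j) • (Δ (p i) * p j + p j * Δ (p i)) := by
    have hl : Δ x * x = ∑ i, ∑ j, (α i * α j) • (Δ (p i) * p j) := by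
      simp only [hx, map_sum, map_smul, Finset.sum_mul_sum, smul_mul_smul_comm]
    have hr : x * Δ x = ∑ i, ∑ j, (α i * α j) • (p j * Δ (p i)) := by
      simp only [hx, map_sum, map_smul, Finset.sum_mul_sum, smul_mul_smul_comm]
      rw [Finset.sum_comm]
      simp only [mul_comm]
    simp only [hl, hr, smul_add, Finset.sum_add_distrib]
  have hdouble : (Δ x * x + x * Δ x) + (Δ x * x + x * Δ x) = Δ (x * x) + Δ (x * x) := by
    rw [hexp]
    nth_rewrite 2 [Finset.sum_comm]
    rw [hsq, map_sum, ← Finset.sum_add_distrib, ← Finset.sum_add_distrib]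
    refine Finset.sum_congr rfl fun i _ => ?_
    rw [← Finset.sum_add_distrib, Finset.sum_eq_single i]
    · rw [← h _ (hidem i), map_smul]
    · intro j _ hj
      rw [mul_comm (α j), ← smul_add,
        jordan_cross_terms_eq_zero Δ h (hidem i) (hidem j) (horth i j hj.symm) (horth j i hj),
        smul_zero]
    · simp
  rw [← two_smul ℂ, ← two_smul ℂ (Δ (x * x))] at hdouble
  exact (smul_right_injective A (two_ne_zero : (2 : ℂ) ≠ 0) hdouble).symm
end

section
/- Let A be a unital associative algebra over ℂ and Δ : A → A a local derivation. Then Δ is homogeneous with respect to central idempotents: for every idempotent z ∈ A lying in the center of A and every x ∈ A, Δ(zx) = zΔ(x). -/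
/-- A derivation commutes with multiplication by a central idempotent. -/
theorem derivation_central_idempotent_mul
    {A : Type*} [Ring A] (D : A → A)
    (hD : ∀ a b : A, D (a * b) = D a * b + a * D b)
    {z : A} (hz : z * z = z) (hzc : ∀ y : A, z * y = y * z) (y : A) :
    D (z * y) = z * D y := by
  have hDz : D z = z * D z + z * D z := by
    have h := hD z z
    rwa [hz, ← hzc] at h
  have hzDz : z * D z = 0 := by
    have h := congrArg (z * ·) hDz
    simpa only [mul_add, ← mul_assoc, hz, left_eq_add] using h
  rw [hD, hDz, hzDz, add_zero, zero_mul, zero_add]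

/-- Lemma 2.4: Every local derivation on a unital associative
ℂ-algebra is homogeneous with respect to central idempotents:
Δ(z x) = z Δ(x) for every central idempotent z. -/
theorem local_derivation_central_idempotent_homogeneous
    {A : Type*} [Ring A] [Algebra ℂ A] (Δ : A →ₗ[ℂ] A)
    (hloc : ∀ x : A, ∃ D : A →ₗ[ℂ] A,
      (∀ a b : A, D (a * b) = D a * b + a * D b) ∧ Δ x = D x)
    (z : A) (hz : z * z = z) (hzc : ∀ y : A, z * y = y * z)
    (x : A) :
    Δ (z * x) = z * Δ x := by
  have hfix : z * Δ (z * x) = Δ (z * x) := by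
    obtain ⟨D, hD, h⟩ := hloc (z * x)
    rw [h, ← derivation_central_idempotent_mul D hD hz hzc, ← mul_assoc, hz]
  have hcompl : z * Δ (x - z * x) = 0 := by
    obtain ⟨D, hD, h⟩ := hloc (x - z * x)
    rw [h, ← derivation_central_idempotent_mul D hD hz hzc, mul_sub, ← mul_assoc, hz,
      sub_self, map_zero]
  rw [map_sub, mul_sub, hfix, sub_eq_zero] at hcompl
  exact hcompl.symm
end

section
/- Let A be a commutative von Neumann regular algebra over ℂ (for every a ∈ A there exists b ∈ A with a = aba). If D : A → A is a derivation such that D ∘ D is also a derivation, then D = 0. Consequently, for a derivation D on A, D² is a derivation if and only if D ≡ 0. -/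
/-- Lemma 3.6: On a commutative von Neumann regular ℂ-algebra,
if D is a derivation, then D ∘ D is a derivation if and only if D = 0. -/
theorem derivation_square_is_derivation_iff_zero
    {A : Type*} [CommRing A] [Algebra ℂ A]
    (hreg : ∀ a : A, ∃ b : A, a = a * b * a)
    (D : A →ₗ[ℂ] A)
    (hD : ∀ x y : A, D (x * y) = D x * y + x * D y) :
    (∀ x y : A, (D ∘ₗ D) (x * y) = (D ∘ₗ D) x * y + x * (D ∘ₗ D) y) ↔ D = 0 := by
  constructor
  · intro h
    ext x
    have hxx := h x x
    simp only [LinearMap.comp_apply, hD, map_add] at hxx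
    have htwo : (2 : ℂ) • (D x * D x) = 0 := by
      rw [two_smul]
      linear_combination hxx
    have hsq : D x * D x = 0 := (smul_eq_zero_iff_right two_ne_zero).mp htwo
    obtain ⟨b, hb⟩ := hreg (D x)
    rw [LinearMap.zero_apply]
    linear_combination hb + b * hsq
  · rintro rfl
    simp
end

section
/- Let (Ω,Σ,μ) be a finite measure space and L⁰ = L⁰(Ω,Σ,μ) the algebra of equivalence classes of measurable complex functions on Ω. Let Δ : L⁰ → L⁰ be a ℂ-linear map such that (a) for every f ∈ L⁰, Δ(f) = 0 μ-a.e. on the set {ω : f(ω) = 0}, and (b) Δ(χ_E) = 0 for every measurable set E ∈ Σ (χ_E the indicator function). Then Δ(f) = 0 for every f ∈ L⁰ whose essential range is countable, i.e. for every f for which there is a countable set C ⊆ ℂ with f(ω) ∈ C for μ-a.e. ω. -/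
open MeasureTheory

/-- The commutative ring structure on `L⁰ = Ω →ₘ[μ] ℂ`, the algebra of
equivalence classes (modulo `μ`-a.e. equality) of measurable complex
functions, with pointwise operations. -/
noncomputable instance AEEqFunCommRing {Ω : Type*} [MeasurableSpace Ω] {μ : Measure Ω} :
    CommRing (Ω →ₘ[μ] ℂ) :=
  { (inferInstance : AddCommGroup (Ω →ₘ[μ] ℂ)),
    (inferInstance : CommMonoid (Ω →ₘ[μ] ℂ)) with
    left_distrib := fun f g h => AEEqFun.toGerm_injective <| by
      simp [AEEqFun.mul_toGerm, AEEqFun.add_toGerm, mul_add]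
    right_distrib := fun f g h => AEEqFun.toGerm_injective <| by
      simp [AEEqFun.mul_toGerm, AEEqFun.add_toGerm, add_mul]
    zero_mul := fun f => AEEqFun.toGerm_injective <| by
      simp [AEEqFun.mul_toGerm, AEEqFun.zero_toGerm]
    mul_zero := fun f => AEEqFun.toGerm_injective <| by
      simp [AEEqFun.mul_toGerm, AEEqFun.zero_toGerm] }

/-- The indicator function `χ_E` of a measurable set `E`, as an element of `L⁰`. -/
noncomputable def indAE {Ω : Type*} [MeasurableSpace Ω] (μ : Measure Ω)
    (E : Set Ω) (hE : MeasurableSet E) : Ω →ₘ[μ] ℂ :=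
  AEEqFun.mk (E.indicator fun _ => (1 : ℂ)) (aestronglyMeasurable_const.indicator hE)

/-- `f ∈ L⁰` is countably valued: there is a countable `C ⊆ ℂ` with `f ω ∈ C` a.e.
These elements form the subalgebra `K_c`. -/
def CountablyValued {Ω : Type*} [MeasurableSpace Ω] {μ : Measure Ω}
    (f : Ω →ₘ[μ] ℂ) : Prop :=
  ∃ C : Set ℂ, C.Countable ∧ ∀ᵐ ω ∂μ, f ω ∈ C

/-- A derivation on `L⁰`: a ℂ-linear map satisfying the Leibniz rule. -/
def IsDeriv {Ω : Type*} [MeasurableSpace Ω] {μ : Measure Ω}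
    (D : (Ω →ₘ[μ] ℂ) →ₗ[ℂ] (Ω →ₘ[μ] ℂ)) : Prop :=
  ∀ f g : Ω →ₘ[μ] ℂ, D (f * g) = D f * g + f * D g

/-- A local derivation on `L⁰`: a ℂ-linear map which agrees at every point
with some derivation. -/
def IsLocalDeriv {Ω : Type*} [MeasurableSpace Ω] {μ : Measure Ω}
    (Δ : (Ω →ₘ[μ] ℂ) →ₗ[ℂ] (Ω →ₘ[μ] ℂ)) : Prop :=
  ∀ f : Ω →ₘ[μ] ℂ, ∃ D : (Ω →ₘ[μ] ℂ) →ₗ[ℂ] (Ω →ₘ[μ] ℂ), IsDeriv D ∧ Δ f = D f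

/-- `g ∈ L⁰` is integral with respect to the subalgebra `K_c` of countably valued
elements: it satisfies a monic polynomial equation with coefficients in `K_c`. -/
def IntegralOverKc {Ω : Type*} [MeasurableSpace Ω] {μ : Measure Ω}
    (g : Ω →ₘ[μ] ℂ) : Prop :=
  ∃ n : ℕ, 1 ≤ n ∧ ∃ c : Fin n → (Ω →ₘ[μ] ℂ),
    (∀ i, CountablyValued (c i)) ∧ g ^ n + ∑ i : Fin n, c i * g ^ (i : ℕ) = 0

/-- If a ℂ-linear map Δ on L⁰(Ω,Σ,μ) (μ a finite measure)
vanishes a.e. on the zero set of each function and kills all indicator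
functions, then Δ vanishes on all countably valued elements. -/
theorem vanishes_on_countably_valued
    {Ω : Type*} [MeasurableSpace Ω] (μ : Measure Ω) [IsFiniteMeasure μ]
    (Δ : (Ω →ₘ[μ] ℂ) →ₗ[ℂ] (Ω →ₘ[μ] ℂ))
    (hsupp : ∀ f : Ω →ₘ[μ] ℂ, ∀ᵐ ω ∂μ, f ω = 0 → Δ f ω = 0)
    (hind : ∀ (E : Set Ω) (hE : MeasurableSet E), Δ (indAE μ E hE) = 0)
    (f : Ω →ₘ[μ] ℂ) (hf : CountablyValued f) :
    Δ f = 0 := by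
  obtain ⟨C, hC, hfC⟩ := hf
  have key : ∀ c : ℂ, ∀ᵐ ω ∂μ, f ω = c → Δ f ω = 0 := by
    intro c
    have hΔ : Δ (f - c • indAE μ Set.univ MeasurableSet.univ) = Δ f := by
      rw [map_sub, map_smul, hind, smul_zero, sub_zero]
    have h := hsupp (f - c • indAE μ Set.univ MeasurableSet.univ)
    rw [hΔ] at h
    filter_upwards [h, AEEqFun.coeFn_sub f (c • indAE μ Set.univ MeasurableSet.univ),
      AEEqFun.coeFn_smul c (indAE μ Set.univ MeasurableSet.univ),
      AEEqFun.coeFn_mk (Set.univ.indicator fun _ => (1 : ℂ))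
        (aestronglyMeasurable_const.indicator (μ := μ) MeasurableSet.univ)]
      with ω h0 hsub hsmul hone hfc
    apply h0
    have hone' : indAE μ Set.univ MeasurableSet.univ ω = 1 := by
      simpa [indAE] using hone
    refine hsub.trans ?_
    rw [Pi.sub_apply, hsmul, Pi.smul_apply, hone', hfc]
    simp
  have hall : ∀ᵐ ω ∂μ, ∀ c ∈ C, f ω = c → Δ f ω = 0 :=
    (ae_ball_iff hC).2 fun c _ => key c
  refine AEEqFun.ext ?_
  filter_upwards [hfC, hall, AEEqFun.coeFn_zero (α := Ω) (β := ℂ) (μ := μ)] with ω hω h h0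
  exact (h _ hω rfl).trans h0.symm
end

section
/- Let (Ω,Σ,μ) be a finite measure space and L⁰ = L⁰(Ω,Σ,μ) the algebra of equivalence classes of measurable complex functions on Ω. A ℂ-linear map Δ : L⁰ → L⁰ is a local derivation if and only if it satisfies the two conditions: (a) for every f ∈ L⁰, Δ(f) = 0 μ-a.e. on the set {ω : f(ω) = 0}, and (b) Δ(χ_E) = 0 for every measurable set E ∈ Σ. -/
open MeasureTheory

section Algebra

open scoped Polynomial KaehlerDifferential

namespace KaehlerDifferential

/-- In characteristic zero, the differential of a transcendental element is nonzero. -/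
theorem D_ne_zero_of_transcendental {k K : Type*} [Field k] [CharZero k] [Field K]
    [Algebra k K] {x : K} (hx : Transcendental k x) : D k K x ≠ 0 := by
  let _ : Algebra k[X] K := (Polynomial.aeval x).toAlgebra
  have hX : algebraMap k[X] K Polynomial.X = x := Polynomial.aeval_X x
  have : IsScalarTower k k[X] K := .of_algHom (Polynomial.aeval x)
  have : FaithfulSMul k[X] K := (faithfulSMul_iff_algebraMap_injective _ _).2
    (transcendental_iff_injective.1 hx)
  let _ : Algebra (FractionRing k[X]) K := FractionRing.liftAlgebra k[X] K
  have : IsScalarTower k[X] (FractionRing k[X]) K := FractionRing.isScalarTower_liftAlgebra k[X] K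
  have : CharZero (FractionRing k[X]) := charZero_of_injective_algebraMap
    (IsFractionRing.injective k[X] (FractionRing k[X]))
  obtain ⟨ι, v, hv⟩ := exists_isTranscendenceBasis' (FractionRing k[X]) K
  have := hv.isAlgebraic_field
  have : Algebra.FormallySmooth (FractionRing k[X]) K :=
    .of_algebraicIndependent_of_isSeparable hv.1
  have : Algebra.FormallySmooth k[X] (FractionRing k[X]) :=
    .of_isLocalization (nonZeroDivisors k[X])
  have : Algebra.FormallySmooth k[X] K := .comp k[X] (FractionRing k[X]) K
  have hinj : Function.Injective (mapBaseChange k k[X] K) := by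
    rw [injective_iff_map_eq_zero]
    intro y hy
    obtain ⟨z, rfl⟩ := (Algebra.H1Cotangent.exact_δ_mapBaseChange k k[X] K y).1 hy
    rw [Subsingleton.elim z 0, map_zero]
  intro h
  have h0 : (1 : K) ⊗ₜ[k[X]] D k k[X] Polynomial.X = 0 := hinj (by simp [hX, h])
  have h1 := congrArg (TensorProduct.rid k[X] K ∘
    (polynomialEquiv k).toLinearMap.lTensor K) h0
  simp [polynomialEquiv_D] at h1

end KaehlerDifferential

/-- If `g` is divisible by all the elements `f - c` with `c` in the algebraically closed field `k`,
then every annihilator of the differential of `f` annihilates `g` up to nilpotents. -/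
theorem isNilpotent_mul_of_smul_D_eq_zero {k A : Type*} [Field k] [CharZero k] [IsAlgClosed k]
    [CommRing A] [Algebra k A] {f g a : A} (hfg : ∀ c : k, f - algebraMap k A c ∣ g)
    (ha : a • KaehlerDifferential.D k A f = 0) : IsNilpotent (a * g) := by
  rw [nilpotent_iff_mem_prime]
  intro m hm
  by_contra hag
  have ha' : algebraMap A m.ResidueField a ≠ 0 := fun h =>
    hag (m.mul_mem_right g (Ideal.algebraMap_residueField_eq_zero.1 h))
  have hg : g ∉ m := fun h => hag (m.mul_mem_left a h)
  have hf : Transcendental k (algebraMap A m.ResidueField f) := by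
    intro halg
    obtain ⟨c, hc⟩ := minpoly.mem_range_of_degree_eq_one k _
      (IsAlgClosed.degree_eq_one_of_irreducible k (minpoly.irreducible halg.isIntegral))
    refine hg (m.mem_of_dvd (hfg c) (Ideal.algebraMap_residueField_eq_zero.1 ?_))
    rw [map_sub, ← IsScalarTower.algebraMap_apply, hc, sub_self]
  have h := congrArg (KaehlerDifferential.map k k A m.ResidueField) ha
  rw [map_smul, KaehlerDifferential.map_D, map_zero, ← algebraMap_smul m.ResidueField a] at h
  exact (smul_ne_zero ha' (KaehlerDifferential.D_ne_zero_of_transcendental hf)) h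

/-- In a reduced self-injective algebra `A` over an algebraically closed field `k`, an element
divisible by all the `f - c` with `c` in `k` is the value at `f` of some derivation. -/
theorem Derivation.exists_apply_eq_of_forall_sub_dvd {k A : Type*} [Field k] [CharZero k]
    [IsAlgClosed k] [CommRing A] [IsReduced A] [Algebra k A] (hA : Module.Baer A A) {f g : A}
    (hfg : ∀ c : k, f - algebraMap k A c ∣ g) : ∃ d : Derivation k A A, d f = g := by
  let u : A →ₗ[A] Ω[A⁄k] := LinearMap.toSpanSingleton A _ (KaehlerDifferential.D k A f)
  have hu : LinearMap.ker u ≤ LinearMap.ker (LinearMap.toSpanSingleton A A g) := by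
    intro a ha
    exact (isNilpotent_mul_of_smul_D_eq_zero hfg (by simpa [u] using ha)).eq_zero
  obtain ⟨v, hv⟩ := hA.extension_property ((LinearMap.ker u).liftQ u le_rfl)
    (LinearMap.ker_eq_bot.1 (Submodule.ker_liftQ_eq_bot' _ u rfl))
    ((LinearMap.ker u).liftQ (LinearMap.toSpanSingleton A A g) hu)
  refine ⟨v.compDer (KaehlerDifferential.D k A), ?_⟩
  change v (KaehlerDifferential.D k A f) = g
  have := LinearMap.congr_fun hv ((LinearMap.ker u).mkQ 1)
  simpa only [LinearMap.comp_apply, Submodule.mkQ_apply, Submodule.liftQ_apply, u,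
    LinearMap.toSpanSingleton_apply, one_smul] using this

end Algebra

/-- A family of measurable sets closed under finite unions has a countable subfamily whose union
covers every member up to a null set. -/
theorem exists_seq_forall_measure_diff_iUnion_eq_zero {Ω : Type*} [MeasurableSpace Ω]
    (μ : Measure Ω) [IsFiniteMeasure μ] {P : Set Ω → Prop} (hP : ∀ E, P E → MeasurableSet E)
    (h_empty : P ∅) (h_union : ∀ E F, P E → P F → P (E ∪ F)) :
    ∃ E : ℕ → Set Ω, (∀ n, P (E n)) ∧ ∀ F, P F → μ (F \ ⋃ n, E n) = 0 := by
  obtain ⟨u, -, hu, huS⟩ := exists_seq_tendsto_sSup (S := {x | ∃ E, P E ∧ μ E = x})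
    ⟨_, ∅, h_empty, rfl⟩ (OrderTop.bddAbove _)
  choose E hE hEu using huS
  refine ⟨E, hE, fun F hF => ?_⟩
  have hacc : ∀ n, P (F ∪ Set.accumulate E n) := by
    intro n
    induction n with
    | zero => simpa using h_union _ _ hF (hE 0)
    | succ n ih =>
      rw [Set.accumulate_succ, ← Set.union_assoc]
      exact h_union _ _ ih (hE _)
  have hlim : μ (F ∪ ⋃ n, E n) ≤ sSup {x | ∃ E, P E ∧ μ E = x} := by
    rw [← Set.iUnion_accumulate, Set.union_iUnion, Monotone.measure_iUnion]
    · exact iSup_le fun n => le_sSup ⟨_, hacc n, rfl⟩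
    · exact fun i j hij => Set.union_subset_union_right F (Set.monotone_accumulate hij)
  have hle : sSup {x | ∃ E, P E ∧ μ E = x} ≤ μ (⋃ n, E n) :=
    le_of_tendsto' hu fun n => hEu n ▸ measure_mono (Set.subset_iUnion E n)
  have hm : MeasurableSet (⋃ n, E n) := .iUnion fun n => hP _ (hE n)
  rw [← Set.union_sdiff_right, measure_sdiff Set.subset_union_right hm.nullMeasurableSet
    (measure_ne_top _ _)]
  exact tsub_eq_zero_of_le (hlim.trans hle)

section

variable {Ω : Type*} [MeasurableSpace Ω] {μ : Measure Ω}

noncomputable instance : Algebra ℂ (Ω →ₘ[μ] ℂ) :=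
  Algebra.ofModule
    (fun c f g => AEEqFun.ext <| by
      filter_upwards [AEEqFun.coeFn_mul (c • f) g, AEEqFun.coeFn_smul c f,
        AEEqFun.coeFn_smul c (f * g), AEEqFun.coeFn_mul f g] with ω h1 h2 h3 h4
      simp [h1, h2, h3, h4, mul_assoc])
    (fun c f g => AEEqFun.ext <| by
      filter_upwards [AEEqFun.coeFn_mul f (c • g), AEEqFun.coeFn_smul c g,
        AEEqFun.coeFn_smul c (f * g), AEEqFun.coeFn_mul f g] with ω h1 h2 h3 h4
      simp [h1, h2, h3, h4, mul_left_comm])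

theorem coeFn_indAE (E : Set Ω) (hE : MeasurableSet E) :
    indAE μ E hE =ᵐ[μ] E.indicator fun _ => (1 : ℂ) :=
  AEEqFun.coeFn_mk _ _

/-- The pointwise inverse of an element of `L⁰`, equal to `0` where the element vanishes. -/
noncomputable def pinv (f : Ω →ₘ[μ] ℂ) : Ω →ₘ[μ] ℂ :=
  AEEqFun.compMeasurable (fun z : ℂ => z⁻¹) measurable_inv f

theorem coeFn_pinv (f : Ω →ₘ[μ] ℂ) : ∀ᵐ ω ∂μ, pinv f ω = (f ω)⁻¹ :=
  AEEqFun.coeFn_compMeasurable _ _ f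

theorem pinv_mul_self (f : Ω →ₘ[μ] ℂ) :
    pinv f * f = indAE μ {ω | f ω ≠ 0} (f.measurable (measurableSet_singleton 0).compl) :=
  AEEqFun.ext <| by
    filter_upwards [AEEqFun.coeFn_mul (pinv f) f, coeFn_pinv f, coeFn_indAE {ω | f ω ≠ 0}
      (f.measurable (measurableSet_singleton 0).compl)] with ω h1 h2 h3
    by_cases h : f ω = 0 <;> simp [h1, h2, h3, h]

theorem pinv_mul_self_mul_of_ae {f g : Ω →ₘ[μ] ℂ} (h : ∀ᵐ ω ∂μ, f ω = 0 → g ω = 0) :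
    pinv f * f * g = g :=
  AEEqFun.ext <| by
    filter_upwards [AEEqFun.coeFn_mul (pinv f * f) g, AEEqFun.coeFn_mul (pinv f) f, coeFn_pinv f, h]
      with ω h1 h2 h3 h4
    by_cases hf : f ω = 0 <;> simp [h1, h2, h3, hf, h4]

theorem pinv_mul_self_mul_self (f : Ω →ₘ[μ] ℂ) : pinv f * f * f = f :=
  pinv_mul_self_mul_of_ae (.of_forall fun _ => id)

instance : IsReduced (Ω →ₘ[μ] ℂ) :=
  (isReduced_iff_pow_one_lt 2 one_lt_two).2 fun f hf => by
    rw [← pinv_mul_self_mul_self f, mul_assoc, ← sq, hf, mul_zero]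

theorem dvd_of_ae {f g : Ω →ₘ[μ] ℂ} (h : ∀ᵐ ω ∂μ, f ω = 0 → g ω = 0) : f ∣ g :=
  ⟨pinv f * g, by rw [← mul_assoc, mul_comm f, pinv_mul_self_mul_of_ae h]⟩

theorem ae_eq_zero_of_dvd {f g : Ω →ₘ[μ] ℂ} (h : f ∣ g) : ∀ᵐ ω ∂μ, f ω = 0 → g ω = 0 := by
  obtain ⟨r, rfl⟩ := h
  filter_upwards [AEEqFun.coeFn_mul f r] with ω h1 h2
  simp [h1, h2]

theorem indAE_univ : indAE μ Set.univ .univ = 1 :=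
  AEEqFun.ext <| by
    filter_upwards [coeFn_indAE (μ := μ) Set.univ .univ, AEEqFun.coeFn_one (μ := μ) (β := ℂ)]
      with ω h1 h2
    simp [h1, h2]

theorem indAE_empty : indAE μ ∅ .empty = 0 :=
  AEEqFun.ext <| by
    filter_upwards [coeFn_indAE (μ := μ) ∅ .empty, AEEqFun.coeFn_zero (μ := μ) (β := ℂ)]
      with ω h1 h2
    simp [h1, h2]

theorem indAE_mul_self (E : Set Ω) (hE : MeasurableSet E) :
    indAE μ E hE * indAE μ E hE = indAE μ E hE :=
  AEEqFun.ext <| by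
    filter_upwards [coeFn_indAE (μ := μ) E hE, AEEqFun.coeFn_mul (indAE μ E hE) (indAE μ E hE)]
      with ω h1 h2
    by_cases h : ω ∈ E <;> simp [h1, h2, h]

theorem indAE_union (E F : Set Ω) (hE : MeasurableSet E) (hF : MeasurableSet F) :
    indAE μ (E ∪ F) (hE.union hF) =
      indAE μ E hE + indAE μ F hF - indAE μ E hE * indAE μ F hF :=
  AEEqFun.ext <| by
    filter_upwards [coeFn_indAE (μ := μ) E hE, coeFn_indAE (μ := μ) F hF,
      coeFn_indAE (μ := μ) _ (hE.union hF), AEEqFun.coeFn_mul (indAE μ E hE) (indAE μ F hF),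
      AEEqFun.coeFn_add (indAE μ E hE) (indAE μ F hF),
      AEEqFun.coeFn_sub (indAE μ E hE + indAE μ F hF) (indAE μ E hE * indAE μ F hF)]
      with ω h1 h2 h3 h4 h5 h6
    rw [h6, Pi.sub_apply, h5, h4, Pi.add_apply, Pi.mul_apply, h1, h2, h3]
    by_cases hE' : ω ∈ E <;> by_cases hF' : ω ∈ F <;> simp [hE', hF']

/-- The algebra `L⁰` of a finite measure is self-injective. -/
theorem baer_aeeqFun [IsFiniteMeasure μ] : Module.Baer (Ω →ₘ[μ] ℂ) (Ω →ₘ[μ] ℂ) := by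
  intro I φ
  obtain ⟨E, hE, hcover⟩ := exists_seq_forall_measure_diff_iUnion_eq_zero μ
    (P := fun E => ∃ hE : MeasurableSet E, indAE μ E hE ∈ I) (fun E h => h.1)
    ⟨.empty, by rw [indAE_empty]; exact I.zero_mem⟩
    (fun E F ⟨hE, hEI⟩ ⟨hF, hFI⟩ => ⟨hE.union hF, by
      rw [indAE_union E F hE hF]
      exact I.sub_mem (I.add_mem hEI hFI) (I.mul_mem_left _ hFI)⟩)
  choose hEm hEI using hE
  obtain ⟨h, hhm, hh⟩ := exists_measurable_piecewise (disjointed E)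
    (fun n => .disjointed hEm n) (fun n => ⇑(φ ⟨_, hEI n⟩)) (fun n => AEEqFun.measurable _)
    (fun i j hij ω hω => ((disjoint_disjointed E hij).le_bot hω).elim)
  let H : Ω →ₘ[μ] ℂ := AEEqFun.mk h hhm.aestronglyMeasurable
  have hH : H =ᵐ[μ] h := AEEqFun.coeFn_mk _ _
  refine ⟨LinearMap.toSpanSingleton _ _ H, fun a ha => ?_⟩
  have hsupp : ∀ᵐ ω ∂μ, a ω ≠ 0 → ω ∈ ⋃ n, E n := by
    have := hcover {ω | a ω ≠ 0} ⟨a.measurable (measurableSet_singleton 0).compl, by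
      rw [← pinv_mul_self]
      exact I.mul_mem_left _ ha⟩
    filter_upwards [measure_eq_zero_iff_ae_notMem.1 this] with ω hω h0
    by_contra h'
    exact hω ⟨h0, h'⟩
  have hzero : ∀ᵐ ω ∂μ, a ω = 0 → φ ⟨a, ha⟩ ω = 0 := by
    apply ae_eq_zero_of_dvd
    refine ⟨pinv a * φ ⟨a, ha⟩, ?_⟩
    rw [← mul_assoc, mul_comm a, ← smul_eq_mul, ← map_smul]
    congr 1
    exact Subtype.ext (pinv_mul_self_mul_self a).symm
  have hloc : ∀ n, indAE μ (E n) (hEm n) * φ ⟨a, ha⟩ = a * φ ⟨_, hEI n⟩ := by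
    intro n
    rw [← smul_eq_mul, ← smul_eq_mul, ← map_smul, ← map_smul]
    congr 1
    exact Subtype.ext (mul_comm _ _)
  have hloc' : ∀ᵐ ω ∂μ, ∀ n, ω ∈ E n → φ ⟨a, ha⟩ ω = a ω * φ ⟨_, hEI n⟩ ω := by
    rw [ae_all_iff]
    intro n
    filter_upwards [coeFn_indAE (μ := μ) (E n) (hEm n),
      AEEqFun.coeFn_mul (indAE μ (E n) (hEm n)) (φ ⟨a, ha⟩),
      AEEqFun.coeFn_mul a (φ ⟨_, hEI n⟩)] with ω h1 h2 h3 hω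
    rw [hloc n, h3] at h2
    simpa [h1, hω] using h2.symm
  rw [LinearMap.toSpanSingleton_apply, smul_eq_mul]
  refine AEEqFun.ext ?_
  filter_upwards [hsupp, hzero, hloc', hH, AEEqFun.coeFn_mul a H] with ω h1 h2 h3 h4 h5
  rw [h5, Pi.mul_apply, h4]
  by_cases h0 : a ω = 0
  · rw [h2 h0, h0, zero_mul]
  · have := h1 h0
    rw [← iUnion_disjointed, Set.mem_iUnion] at this
    obtain ⟨n, hn⟩ := this
    rw [hh n hn, h3 n (disjointed_subset E n hn)]

theorem IsDeriv.ae_eq_zero {D : (Ω →ₘ[μ] ℂ) →ₗ[ℂ] (Ω →ₘ[μ] ℂ)} (hD : IsDeriv D)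
    (f : Ω →ₘ[μ] ℂ) : ∀ᵐ ω ∂μ, f ω = 0 → D f ω = 0 := by
  apply ae_eq_zero_of_dvd
  refine ⟨pinv f * D f + D (pinv f * f), ?_⟩
  conv_lhs => rw [← pinv_mul_self_mul_self f, hD]
  ring

theorem IsDeriv.map_eq_zero_of_mul_self {D : (Ω →ₘ[μ] ℂ) →ₗ[ℂ] (Ω →ₘ[μ] ℂ)} (hD : IsDeriv D)
    {e : Ω →ₘ[μ] ℂ} (he : e * e = e) : D e = 0 := by
  have h := hD e e
  rw [he] at h
  linear_combination (1 - 2 * e) * h - 4 * D e * he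

end

/-- Lemma 3.4 and its converse, for L⁰: a ℂ-linear map Δ on
L⁰(Ω,Σ,μ) (μ a finite measure) is a local derivation if and only if
(a) Δ(f) vanishes a.e. on the zero set of f, for every f, and
(b) Δ kills the indicator function of every measurable set. -/
theorem isLocalDeriv_iff_support_and_indicator_conditions
    {Ω : Type*} [MeasurableSpace Ω] (μ : Measure Ω) [IsFiniteMeasure μ]
    (Δ : (Ω →ₘ[μ] ℂ) →ₗ[ℂ] (Ω →ₘ[μ] ℂ)) :
    IsLocalDeriv Δ ↔
      ((∀ f : Ω →ₘ[μ] ℂ, ∀ᵐ ω ∂μ, f ω = 0 → Δ f ω = 0) ∧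
        (∀ (E : Set Ω) (hE : MeasurableSet E), Δ (indAE μ E hE) = 0)) := by
  constructor
  · refine fun h => ⟨fun f => ?_, fun E hE => ?_⟩
    · obtain ⟨D, hD, hDf⟩ := h f
      rw [hDf]
      exact hD.ae_eq_zero f
    · obtain ⟨D, hD, hDf⟩ := h (indAE μ E hE)
      rw [hDf]
      exact hD.map_eq_zero_of_mul_self (indAE_mul_self E hE)
  · rintro ⟨hsupp, hind⟩ f
    have h1 : Δ 1 = 0 := indAE_univ (μ := μ) ▸ hind Set.univ .univ
    obtain ⟨d, hd⟩ := Derivation.exists_apply_eq_of_forall_sub_dvd (k := ℂ) (g := Δ f)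
      baer_aeeqFun (f := f) fun c => dvd_of_ae <| by
        have := hsupp (f - c • 1)
        rw [map_sub, map_smul, h1, smul_zero, sub_zero] at this
        rwa [Algebra.algebraMap_eq_smul_one]
    refine ⟨d.toLinearMap, fun f g => ?_, hd.symm⟩
    exact (d.leibniz f g).trans
      ((add_comm _ _).trans (congrArg (· + f * d g) (mul_comm g (d f))))
end

section
/- Let (Ω,Σ,μ) be a finite measure space, L⁰ = L⁰(Ω,Σ,μ) the algebra of equivalence classes of measurable complex functions, and K_c ⊆ L⁰ the subalgebra of countably valued elements. Then for every f ∈ L⁰ there exists a measurable set E ∈ Σ such that: (i) χ_E · f is integral with respect to K_c, and moreover χ_E · f ∈ K_c; (ii) if μ(Ω \ E) > 0, then g = χ_{Ω\E} · f is weakly transcendental with respect to K_c, i.e. g ≠ 0 and for every measurable set B ⊆ {ω : g(ω) ≠ 0} with μ(B) > 0 the element χ_B · f is not integral with respect to K_c. -/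
open MeasureTheory

/-- The zeros of monic polynomials of degree `n` with coefficients in countable sets form a
countable set. -/
theorem countable_setOf_monic_zeros {n : ℕ} {C : Fin n → Set ℂ} (hC : ∀ i, (C i).Countable) :
    {z : ℂ | ∃ a : Fin n → ℂ, (∀ i, a i ∈ C i) ∧
      z ^ n + ∑ i : Fin n, a i * z ^ (i : ℕ) = 0}.Countable := by
  have h : (⋃ a ∈ {a : Fin n → ℂ | ∀ i, a i ∈ C i},
      {z : ℂ | z ^ n + ∑ i : Fin n, a i * z ^ (i : ℕ) = 0}).Countable := by
    refine (Set.countable_pi hC).biUnion fun a _ => Set.Finite.countable ?_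
    have hp : (Polynomial.X ^ n + ∑ i : Fin n, Polynomial.C (a i) *
        Polynomial.X ^ (i : ℕ)).Monic := Polynomial.monic_X_pow_add (Polynomial.degree_sum_fin_lt a)
    refine (Polynomial.finite_setOfPred_isRoot hp.ne_zero).subset fun z hz => ?_
    simpa [Polynomial.IsRoot, Polynomial.eval_finsetSum] using hz
  refine h.mono ?_
  rintro z ⟨a, ha, hz⟩
  exact Set.mem_biUnion (show a ∈ {a : Fin n → ℂ | ∀ i, a i ∈ C i} from ha) hz

section

variable {Ω : Type*} [MeasurableSpace Ω] {μ : Measure Ω}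

theorem AEEqFun_coeFn_sum {ι : Type*} (s : Finset ι) (F : ι → (Ω →ₘ[μ] ℂ)) :
    ∀ᵐ ω ∂μ, (∑ i ∈ s, F i) ω = ∑ i ∈ s, F i ω := by
  classical
  induction s using Finset.induction_on with
  | empty =>
    filter_upwards [AEEqFun.coeFn_zero (α := Ω) (β := ℂ) (μ := μ)] with ω h
    simpa using h
  | insert i s hi ih =>
    rw [Finset.sum_insert hi]
    filter_upwards [ih, AEEqFun.coeFn_add (F i) (∑ j ∈ s, F j)] with ω h h'
    rw [Finset.sum_insert hi, ← h]
    exact h'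

theorem indAE_mul_apply (E : Set Ω) (hE : MeasurableSet E) (f : Ω →ₘ[μ] ℂ) :
    ∀ᵐ ω ∂μ, (indAE μ E hE * f) ω = E.indicator f ω := by
  filter_upwards [AEEqFun.coeFn_mul (indAE μ E hE) f, AEEqFun.coeFn_mk
    (E.indicator fun _ => (1 : ℂ)) ((aestronglyMeasurable_const (μ := μ)).indicator hE)]
    with ω h h'
  have h'' : indAE μ E hE ω = E.indicator (fun _ => (1 : ℂ)) ω := h'
  refine h.trans ?_
  rw [Pi.mul_apply, h'']
  by_cases hω : ω ∈ E <;> simp [hω]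

theorem CountablyValued.integralOverKc {g : Ω →ₘ[μ] ℂ} (hg : CountablyValued g) :
    IntegralOverKc g := by
  refine ⟨1, le_rfl, fun _ => -g, fun _ => ?_, by simp⟩
  obtain ⟨C, hC, h⟩ := hg
  refine ⟨(fun z => -z) '' C, hC.image _, ?_⟩
  filter_upwards [h, AEEqFun.coeFn_neg g] with ω h h'
  exact ⟨g ω, h, h'.symm⟩

/-- The values of an element integral over the countably valued elements are zeros of monic
polynomials with coefficients in countable sets, so they lie in a countable set. -/
theorem IntegralOverKc.countablyValued {g : Ω →ₘ[μ] ℂ} (hg : IntegralOverKc g) :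
    CountablyValued g := by
  obtain ⟨n, -, c, hc, h⟩ := hg
  choose C hC hcC using hc
  refine ⟨_, countable_setOf_monic_zeros hC, ?_⟩
  have hmul : ∀ᵐ ω ∂μ, ∀ i, (c i * g ^ (i : ℕ)) ω = c i ω * g ω ^ (i : ℕ) := by
    refine ae_all_iff.2 fun i => ?_
    filter_upwards [AEEqFun.coeFn_mul (c i) (g ^ (i : ℕ)), AEEqFun.coeFn_pow g (i : ℕ)]
      with ω h1 h2
    refine h1.trans ?_
    rw [Pi.mul_apply, h2, Pi.pow_apply]
  filter_upwards [ae_all_iff.2 hcC, hmul, AEEqFun.coeFn_pow g n,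
    AEEqFun_coeFn_sum Finset.univ fun i : Fin n => c i * g ^ (i : ℕ),
    AEEqFun.coeFn_add (g ^ n) (∑ i : Fin n, c i * g ^ (i : ℕ)),
    AEEqFun.coeFn_zero (α := Ω) (β := ℂ) (μ := μ)] with ω hω hm hp hs ha h0
  refine ⟨fun i => c i ω, hω, ?_⟩
  have h1 : (g ^ n + ∑ i : Fin n, c i * g ^ (i : ℕ)) ω = 0 := by
    rw [h]
    exact h0
  rw [← h1]
  refine Eq.trans ?_ ha.symm
  rw [Pi.add_apply, hs, hp, Pi.pow_apply]
  simp only [hm]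

end

/-- Lemma 3.3 for L⁰: for every f ∈ L⁰(Ω,Σ,μ) (μ a finite
measure) there is a measurable set E such that χ_E·f is integral with respect
to K_c (and in fact lies in K_c), while if μ(Ω\E) > 0 then χ_{Ω\E}·f is weakly
transcendental with respect to K_c. -/
theorem exists_integral_weaklyTranscendental_splitting
    {Ω : Type*} [MeasurableSpace Ω] (μ : Measure Ω) [IsFiniteMeasure μ]
    (f : Ω →ₘ[μ] ℂ) :
    ∃ (E : Set Ω) (hE : MeasurableSet E),
      (IntegralOverKc (indAE μ E hE * f) ∧ CountablyValued (indAE μ E hE * f)) ∧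
      (0 < μ Eᶜ →
        indAE μ Eᶜ hE.compl * f ≠ 0 ∧
        ∀ (B : Set Ω) (hB : MeasurableSet B), 0 < μ B →
          (∀ᵐ ω ∂μ, ω ∈ B → (indAE μ Eᶜ hE.compl * f) ω ≠ 0) →
          ¬ IntegralOverKc (indAE μ B hB * f)) := by
  have hf : Measurable f := f.measurable
  set A : Set ℂ := {z | 0 < μ (f ⁻¹' {z})}
  have hA : A.Countable := Measure.countable_meas_pos_of_disjoint_iUnion
    (fun z => hf (measurableSet_singleton z))
    (fun z w hzw => Disjoint.preimage f (Set.disjoint_singleton.2 hzw))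
  have hE : MeasurableSet (f ⁻¹' A) := hf hA.measurableSet
  have hnull : ∀ S : Set ℂ, S.Countable → μ (f ⁻¹' S ∩ (f ⁻¹' A)ᶜ) = 0 := by
    intro S hS
    have hsub : f ⁻¹' S ∩ (f ⁻¹' A)ᶜ ⊆ ⋃ z ∈ S \ A, f ⁻¹' {z} := fun ω hω =>
      Set.mem_biUnion (show f ω ∈ S \ A from hω) rfl
    refine measure_mono_null hsub ?_
    refine (measure_biUnion_null_iff (hS.mono Set.sdiff_subset)).2 fun z hz => ?_
    exact nonpos_iff_eq_zero.1 (not_lt.1 hz.2)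
  have hcv : CountablyValued (indAE μ (f ⁻¹' A) hE * f) := by
    refine ⟨insert 0 A, hA.insert 0, ?_⟩
    filter_upwards [indAE_mul_apply _ hE f] with ω h
    rw [h]
    by_cases hω : ω ∈ f ⁻¹' A
    · rw [Set.indicator_of_mem hω]
      exact Or.inr hω
    · rw [Set.indicator_of_notMem hω]
      exact Or.inl rfl
  refine ⟨f ⁻¹' A, hE, ⟨hcv.integralOverKc, hcv⟩, fun hpos => ⟨fun h0 => ?_, ?_⟩⟩
  · refine hpos.ne' (measure_mono_null_ae ?_ (hnull {0} (Set.countable_singleton 0)))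
    have hz := AEEqFun.coeFn_zero (α := Ω) (β := ℂ) (μ := μ)
    rw [← h0] at hz
    filter_upwards [indAE_mul_apply _ hE.compl f, hz] with ω h h' hω
    refine ⟨?_, hω⟩
    rw [Set.indicator_of_mem (show ω ∈ (f ⁻¹' A)ᶜ from hω)] at h
    exact h.symm.trans h'
  · intro B hB hBpos hne hint
    obtain ⟨S, hS, hBS⟩ := hint.countablyValued
    refine hBpos.ne' (measure_mono_null_ae ?_ (hnull S hS))
    filter_upwards [indAE_mul_apply _ hE.compl f, indAE_mul_apply _ hB f, hne, hBS]
      with ω h1 h2 h3 h4 hω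
    constructor
    · rw [h2, Set.indicator_of_mem (show ω ∈ B from hω)] at h4
      exact h4
    · by_contra hc
      exact h3 hω (h1.trans (Set.indicator_of_notMem hc _))
end

section
/- Let (Ω,Σ,μ) be a finite measure space, L⁰ = L⁰(Ω,Σ,μ) the algebra of equivalence classes of measurable complex functions, and K_c ⊆ L⁰ the subalgebra of countably valued elements. The following conditions are equivalent: (i) K_c ≠ L⁰; (ii) L⁰ admits a non-zero derivation; (iii) L⁰ admits a non-zero local derivation; (iv) L⁰ admits a local derivation which is not a derivation. -/
open MeasureTheory

open scoped IntermediateField.algebraAdjoinAdjoin TensorProduct in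
theorem exists_derivation_eq_one_of_transcendental {k F : Type*} [Field k] [CharZero k] [Field F]
    [Algebra k F] {x : F} (hx : Transcendental k x) : ∃ d : Derivation k F F, d x = 1 := by
  obtain ⟨s, hxs, hs⟩ := exists_isTranscendenceBasis_superset (R := k) (A := F) (s := {x})
    (algebraicIndependent_unique_type_iff.mpr hx)
  have := hs.isAlgebraic_field
  let A := Algebra.adjoin k (Set.range ((↑) : s → F))
  let M := IntermediateField.adjoin k (Set.range ((↑) : s → F))
  have : Algebra.FormallyEtale A M := .of_isLocalization (nonZeroDivisors _)
  have : Algebra.FormallyEtale M F := .of_isSeparable M F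
  have : Algebra.FormallyEtale A F := .comp A M F
  let e : MvPolynomial s k ≃ₐ[k] A := hs.1.aevalEquiv
  let i : s := ⟨x, hxs rfl⟩
  let a : A := e (.X i)
  have ha : algebraMap A F a = x := (hs.1.algebraMap_aevalEquiv _).trans (by simp [i])
  let d₀ : Derivation k A F := (Derivation.mk'
    ((Algebra.linearMap A F).restrictScalars k ∘ₗ e.toLinearMap ∘ₗ
      (MvPolynomial.pderiv i).toLinearMap ∘ₗ e.symm.toLinearMap) fun p q => by
        simp [Derivation.leibniz, Algebra.smul_def])
  let L : F ⊗[A] Ω[A⁄k] →ₗ[F] F := LinearMap.liftBaseChange F d₀.liftKaehlerDifferential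
  refine ⟨(L ∘ₗ (KaehlerDifferential.tensorKaehlerEquivOfFormallyEtale
    k A F).symm.toLinearMap).compDer (KaehlerDifferential.D k F), ?_⟩
  have h := KaehlerDifferential.tensorKaehlerEquivOfFormallyEtale_symm_D_algebraMap k A F a
  rw [ha] at h
  simp [h, L, d₀, a]

theorem Module.Baer.exists_derivation_apply_eq {k R : Type*} [CommRing k] [CommRing R]
    [Algebra k R] (hR : Module.Baer R R) {x y : R}
    (h : ∀ a : R, a • KaehlerDifferential.D k R x = 0 → a * y = 0) :
    ∃ d : Derivation k R R, d x = y := by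
  let f := LinearMap.toSpanSingleton R _ (KaehlerDifferential.D k R x)
  obtain ⟨φ, hφ⟩ := hR.extension_property (f.ker.liftQ f le_rfl)
    (LinearMap.ker_eq_bot.mp (Submodule.ker_liftQ_eq_bot' _ _ rfl))
    (f.ker.liftQ (LinearMap.toSpanSingleton R R y) fun a ha => h a ha)
  refine ⟨φ.compDer (KaehlerDifferential.D k R), ?_⟩
  have h₁ : φ (f 1) = LinearMap.toSpanSingleton R R y 1 :=
    LinearMap.congr_fun hφ (Submodule.Quotient.mk 1)
  simpa [f] using h₁

theorem mem_or_exists_sub_algebraMap_mem_of_smul_D_eq_zero {k R : Type*} [Field k] [CharZero k]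
    [IsAlgClosed k] [CommRing R] [Algebra k R] {a x : R}
    (h : a • KaehlerDifferential.D k R x = 0) (m : Ideal R) [hm : m.IsMaximal] :
    a ∈ m ∨ ∃ c : k, x - algebraMap k R c ∈ m := by
  let := Ideal.Quotient.field m
  by_cases hx : IsAlgebraic k (Ideal.Quotient.mk m x)
  · right
    obtain ⟨c, hc⟩ := minpoly.mem_range_of_degree_eq_one k _
      (IsAlgClosed.degree_eq_one_of_irreducible k (minpoly.irreducible hx.isIntegral))
    exact ⟨c, Ideal.Quotient.eq.mp hc.symm⟩
  · left
    obtain ⟨d, hd⟩ := exists_derivation_eq_one_of_transcendental hx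
    have h₀ := congrArg (d.compAlgebraMap R).liftKaehlerDifferential h
    rw [map_smul, Derivation.liftKaehlerDifferential_comp_D, map_zero] at h₀
    have h₁ : Ideal.Quotient.mk m a * d (Ideal.Quotient.mk m x) = 0 := h₀
    rwa [hd, mul_one, Ideal.Quotient.eq_zero_iff_mem] at h₁

section L0

variable {Ω : Type*} [MeasurableSpace Ω] {μ : Measure Ω}

noncomputable instance AEEqFunAlgebra : Algebra ℂ (Ω →ₘ[μ] ℂ) :=
  Algebra.ofModule
    (fun c f g => by
      apply AEEqFun.ext
      filter_upwards [AEEqFun.coeFn_mul (c • f) g, AEEqFun.coeFn_smul c f,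
        AEEqFun.coeFn_smul c (f * g), AEEqFun.coeFn_mul f g] with ω h₁ h₂ h₃ h₄
      simp [h₁, h₂, h₃, h₄, mul_assoc])
    (fun c f g => by
      apply AEEqFun.ext
      filter_upwards [AEEqFun.coeFn_mul f (c • g), AEEqFun.coeFn_smul c g,
        AEEqFun.coeFn_smul c (f * g), AEEqFun.coeFn_mul f g] with ω h₁ h₂ h₃ h₄
      simp [h₁, h₂, h₃, h₄, mul_left_comm])

theorem Derivation.isDeriv (d : Derivation ℂ (Ω →ₘ[μ] ℂ) (Ω →ₘ[μ] ℂ)) :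
    IsDeriv (d : (Ω →ₘ[μ] ℂ) →ₗ[ℂ] (Ω →ₘ[μ] ℂ)) := fun f g => by
  simp [Derivation.leibniz, mul_comm g, add_comm]

theorem coeFn_algebraMap (c : ℂ) : algebraMap ℂ (Ω →ₘ[μ] ℂ) c =ᵐ[μ] fun _ => c := by
  rw [Algebra.algebraMap_eq_smul_one]
  filter_upwards [AEEqFun.coeFn_smul c (1 : Ω →ₘ[μ] ℂ), AEEqFun.coeFn_one (μ := μ) (β := ℂ)]
    with ω h₁ h₂
  simp [h₁, h₂]

theorem exists_mul_eq_indAE_support (f : Ω →ₘ[μ] ℂ) :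
    ∃ g, g * f = indAE μ (Function.support f) (measurableSet_support f.measurable) := by
  refine ⟨AEEqFun.mk (fun ω => (f ω)⁻¹) f.measurable.inv.aestronglyMeasurable, ?_⟩
  apply AEEqFun.ext
  filter_upwards [AEEqFun.coeFn_mul (AEEqFun.mk (fun ω => (f ω)⁻¹)
    f.measurable.inv.aestronglyMeasurable) f, AEEqFun.coeFn_mk (μ := μ) (fun ω => (f ω)⁻¹)
    f.measurable.inv.aestronglyMeasurable, coeFn_indAE (μ := μ) _
      (measurableSet_support f.measurable)] with ω h₁ h₂ h₃
  by_cases hω : f ω = 0 <;> simp [h₁, h₂, h₃, hω]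

theorem isUnit_of_ae_ne_zero {f : Ω →ₘ[μ] ℂ} (hf : ∀ᵐ ω ∂μ, f ω ≠ 0) : IsUnit f := by
  obtain ⟨g, hg⟩ := exists_mul_eq_indAE_support f
  refine IsUnit.of_mul_eq_one_right g (hg.trans (AEEqFun.ext ?_))
  filter_upwards [hf, coeFn_indAE (μ := μ) _ (measurableSet_support f.measurable),
    AEEqFun.coeFn_one (μ := μ) (β := ℂ)] with ω h₁ h₂ h₃
  simp [h₁, h₂, h₃]

theorem IsDeriv.map_indAE {D : (Ω →ₘ[μ] ℂ) →ₗ[ℂ] (Ω →ₘ[μ] ℂ)} (hD : IsDeriv D)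
    (E : Set Ω) (hE : MeasurableSet E) : D (indAE μ E hE) = 0 := by
  have h := indAE_mul_self (μ := μ) E hE
  have h₁ := hD (indAE μ E hE) (indAE μ E hE)
  rw [h] at h₁
  have h₂ := congrArg (indAE μ E hE * ·) h₁
  linear_combination h₁ - 4 * D (indAE μ E hE) * h - 2 * h₂

theorem IsDeriv.map_indAE_mul {D : (Ω →ₘ[μ] ℂ) →ₗ[ℂ] (Ω →ₘ[μ] ℂ)} (hD : IsDeriv D)
    (E : Set Ω) (hE : MeasurableSet E) (f : Ω →ₘ[μ] ℂ) :
    D (indAE μ E hE * f) = indAE μ E hE * D f := by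
  rw [hD, hD.map_indAE, zero_mul, zero_add]

/-- Where `f` takes the value `c`, every derivation of `f` vanishes. -/
theorem IsDeriv.indAE_mul_apply {D : (Ω →ₘ[μ] ℂ) →ₗ[ℂ] (Ω →ₘ[μ] ℂ)} (hD : IsDeriv D)
    (f : Ω →ₘ[μ] ℂ) (c : ℂ) :
    indAE μ (f ⁻¹' {c}) (f.measurable (measurableSet_singleton c)) * D f = 0 := by
  have h : indAE μ (f ⁻¹' {c}) (f.measurable (measurableSet_singleton c)) * f =
      c • indAE μ (f ⁻¹' {c}) (f.measurable (measurableSet_singleton c)) := by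
    apply AEEqFun.ext
    filter_upwards [coeFn_indAE (μ := μ) (f ⁻¹' {c}) (f.measurable (measurableSet_singleton c)),
      AEEqFun.coeFn_mul (indAE μ (f ⁻¹' {c}) (f.measurable (measurableSet_singleton c))) f,
      AEEqFun.coeFn_smul c (indAE μ (f ⁻¹' {c}) (f.measurable (measurableSet_singleton c)))]
      with ω h₁ h₂ h₃
    by_cases hω : f ω = c <;> simp [h₁, h₂, h₃, hω]
  rw [← hD.map_indAE_mul, h, map_smul, hD.map_indAE, smul_zero]

theorem ae_eq_zero_of_indAE_mul_eq_zero {f : Ω →ₘ[μ] ℂ} {E : Set Ω} {hE : MeasurableSet E}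
    (h : indAE μ E hE * f = 0) : ∀ᵐ ω ∂μ, ω ∈ E → f ω = 0 := by
  filter_upwards [coeFn_indAE (μ := μ) E hE, AEEqFun.coeFn_mul (indAE μ E hE) f,
    h ▸ AEEqFun.coeFn_zero (μ := μ) (β := ℂ)] with ω h₁ h₂ h₃ hω
  simpa [h₁, hω, h₃] using h₂.symm

theorem IsDeriv.ae_apply_eq_zero {D : (Ω →ₘ[μ] ℂ) →ₗ[ℂ] (Ω →ₘ[μ] ℂ)} (hD : IsDeriv D)
    (f : Ω →ₘ[μ] ℂ) {C : Set ℂ} (hC : C.Countable) : ∀ᵐ ω ∂μ, f ω ∈ C → D f ω = 0 := by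
  have h : ∀ᵐ ω ∂μ, ∀ c ∈ C, f ω = c → D f ω = 0 :=
    (ae_ball_iff hC).mpr fun c _ => ae_eq_zero_of_indAE_mul_eq_zero (hD.indAE_mul_apply f c)
  filter_upwards [h] with ω hω hωC using hω _ hωC rfl

theorem IsDeriv.ae_apply_apply_eq_zero {D : (Ω →ₘ[μ] ℂ) →ₗ[ℂ] (Ω →ₘ[μ] ℂ)} (hD : IsDeriv D)
    (f : Ω →ₘ[μ] ℂ) {C : Set ℂ} (hC : C.Countable) : ∀ᵐ ω ∂μ, f ω ∈ C → D (D f) ω = 0 := by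
  have h : ∀ᵐ ω ∂μ, ∀ c ∈ C, f ω = c → D (D f) ω = 0 :=
    (ae_ball_iff hC).mpr fun c _ => ae_eq_zero_of_indAE_mul_eq_zero (E := f ⁻¹' {c})
      (hE := f.measurable (measurableSet_singleton c)) <| by
        rw [← hD.map_indAE_mul, hD.indAE_mul_apply, map_zero]
  filter_upwards [h] with ω hω hωC using hω _ hωC rfl

/-- `L⁰` is self-injective. -/
theorem baer_aeEqFun [SFinite μ] : Module.Baer (Ω →ₘ[μ] ℂ) (Ω →ₘ[μ] ℂ) := by
  intro I φ
  obtain ⟨S, hS, hSc, hS'⟩ := μ.exists_ae_subset_biUnion_countable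
    (C := {E | ∃ hE : MeasurableSet E, indAE μ E hE ∈ I}) fun E hE => hE.1
  have hne : (insert ∅ S).Nonempty := Set.insert_nonempty _ _
  obtain ⟨E, hE⟩ := (hSc.insert ∅).exists_eq_range hne
  have hEI : ∀ n, ∃ hE : MeasurableSet (E n), indAE μ (E n) hE ∈ I := by
    intro n
    rcases hE ▸ Set.mem_range_self n with h | h
    · refine ⟨h ▸ .empty, ?_⟩
      convert I.zero_mem
      apply AEEqFun.ext
      filter_upwards [coeFn_indAE (μ := μ) (E n) (h ▸ .empty),
        AEEqFun.coeFn_zero (μ := μ) (β := ℂ)] with ω h₁ h₂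
      rw [h₁, h₂, h, Set.indicator_empty, Pi.zero_apply]
    · exact hS h
  choose hEm hEI using hEI
  obtain ⟨r, hr, hrE⟩ := exists_measurable_piecewise (disjointed E)
    (fun n => .disjointed hEm n) (fun n => φ ⟨_, hEI n⟩) (fun n => AEEqFun.measurable _)
    fun i j hij ω hω => ((disjoint_disjointed E hij).le_bot hω).elim
  let R : Ω →ₘ[μ] ℂ := AEEqFun.mk r hr.aestronglyMeasurable
  refine ⟨LinearMap.toSpanSingleton _ _ R, fun x hx => ?_⟩
  have hmul : ∀ n, x * φ ⟨_, hEI n⟩ = indAE μ (E n) (hEm n) * φ ⟨x, hx⟩ := fun n => by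
    simp only [← smul_eq_mul, ← map_smul]
    congr 1
    exact Subtype.ext (mul_comm _ _)
  have hmul' : ∀ᵐ ω ∂μ, ∀ n, x ω * φ ⟨_, hEI n⟩ ω = (E n).indicator 1 ω * φ ⟨x, hx⟩ ω := by
    refine ae_all_iff.mpr fun n => ?_
    filter_upwards [AEEqFun.coeFn_mul x (φ ⟨_, hEI n⟩), coeFn_indAE (μ := μ) (E n) (hEm n),
      hmul n ▸ AEEqFun.coeFn_mul (indAE μ (E n) (hEm n)) (φ ⟨x, hx⟩)] with ω h₁ h₂ h₃
    rw [h₁, Pi.mul_apply, Pi.mul_apply, h₂] at h₃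
    exact h₃
  obtain ⟨y, hy⟩ := exists_mul_eq_indAE_support x
  have hsupp : Function.support x ≤ᵐ[μ] ⋃₀ S :=
    hS' _ ⟨measurableSet_support x.measurable, hy ▸ I.mul_mem_left y hx⟩
  have hx0 : indAE μ (x ⁻¹' {0}) (x.measurable (measurableSet_singleton 0)) * φ ⟨x, hx⟩ = 0 := by
    rw [← smul_eq_mul, ← map_smul]
    convert map_zero φ
    refine Subtype.ext (AEEqFun.ext ?_)
    change _ =ᵐ[μ] (0 : Ω →ₘ[μ] ℂ)
    rw [Submodule.coe_smul, smul_eq_mul]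
    filter_upwards [coeFn_indAE (μ := μ) _ (x.measurable (measurableSet_singleton 0)),
      AEEqFun.coeFn_mul (indAE μ _ (x.measurable (measurableSet_singleton 0))) x,
      AEEqFun.coeFn_zero (μ := μ) (β := ℂ)] with ω h₁ h₂ h₃
    by_cases hω : x ω = 0 <;> simp [h₁, h₂, h₃, hω]
  rw [LinearMap.toSpanSingleton_apply, smul_eq_mul]
  apply AEEqFun.ext
  filter_upwards [AEEqFun.coeFn_mul x R, AEEqFun.coeFn_mk (μ := μ) r hr.aestronglyMeasurable,
    hmul', hsupp, ae_eq_zero_of_indAE_mul_eq_zero hx0] with ω h₁ h₂ h₃ h₄ h₅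
  rw [h₁, Pi.mul_apply, h₂]
  by_cases hω : x ω = 0
  · rw [hω, zero_mul, h₅ hω]
  · obtain ⟨A, hA, hωA⟩ := h₄ hω
    obtain ⟨n, rfl⟩ : A ∈ Set.range E := hE ▸ Set.mem_insert_of_mem _ hA
    obtain ⟨k, hk⟩ := Set.mem_iUnion.mp
      (iUnion_disjointed (f := E) ▸ Set.mem_iUnion_of_mem n hωA)
    rw [hrE k hk, h₃ k]
    simp [disjointed_subset E k hk]

theorem ae_eq_zero_or_mem_countable_of_smul_D_eq_zero {a g : Ω →ₘ[μ] ℂ}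
    (h : a • KaehlerDifferential.D ℂ (Ω →ₘ[μ] ℂ) g = 0) :
    ∃ C : Set ℂ, C.Countable ∧ ∀ᵐ ω ∂μ, a ω = 0 ∨ g ω ∈ C := by
  let J : Ideal (Ω →ₘ[μ] ℂ) :=
    { carrier := {x | ∃ C : Set ℂ, C.Countable ∧ ∀ᵐ ω ∂μ, x ω = 0 ∨ a ω = 0 ∨ g ω ∈ C}
      zero_mem' := ⟨∅, Set.countable_empty, by
        filter_upwards [AEEqFun.coeFn_zero (μ := μ) (β := ℂ)] with ω h₁
        simp [h₁]⟩
      add_mem' := by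
        rintro x y ⟨C, hC, hx⟩ ⟨C', hC', hy⟩
        refine ⟨C ∪ C', hC.union hC', ?_⟩
        filter_upwards [hx, hy, AEEqFun.coeFn_add x y] with ω h₁ h₂ h₃
        rw [h₃, Pi.add_apply, Set.mem_union]
        rcases h₁ with h₁ | h₁ | h₁ <;> rcases h₂ with h₂ | h₂ | h₂ <;> simp [h₁, h₂]
      smul_mem' := by
        rintro x y ⟨C, hC, hy⟩
        refine ⟨C, hC, ?_⟩
        filter_upwards [hy, AEEqFun.coeFn_mul x y] with ω h₁ h₂
        rw [smul_eq_mul, h₂, Pi.mul_apply]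
        rcases h₁ with h₁ | h₁ <;> simp [h₁] }
  by_cases hJ : J = ⊤
  · obtain ⟨C, hC, h₁⟩ : (1 : Ω →ₘ[μ] ℂ) ∈ J := hJ ▸ Submodule.mem_top
    refine ⟨C, hC, ?_⟩
    filter_upwards [h₁, AEEqFun.coeFn_one (μ := μ) (β := ℂ)] with ω h₁ h₂
    simpa [h₂] using h₁
  obtain ⟨m, hm, hJm⟩ := J.exists_le_maximal hJ
  -- The indicator of the zero set of an element of `m` is never in `J`, as their sum is a unit.
  have key : ∀ x ∈ m, indAE μ (x ⁻¹' {0}) (x.measurable (measurableSet_singleton 0)) ∉ J := by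
    intro x hx hxJ
    refine hm.ne_top (Ideal.eq_top_of_isUnit_mem m (m.add_mem hx (hJm hxJ))
      (isUnit_of_ae_ne_zero ?_))
    filter_upwards [AEEqFun.coeFn_add x
      (indAE μ (x ⁻¹' {0}) (x.measurable (measurableSet_singleton 0))),
      coeFn_indAE (μ := μ) _ (x.measurable (measurableSet_singleton 0))] with ω h₁ h₂
    by_cases hω : x ω = 0 <;> simp [h₁, h₂, hω]
  exfalso
  rcases mem_or_exists_sub_algebraMap_mem_of_smul_D_eq_zero h m with ha | ⟨c, hc⟩
  · refine key a ha ⟨∅, Set.countable_empty, ?_⟩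
    filter_upwards [coeFn_indAE (μ := μ) _ (a.measurable (measurableSet_singleton 0))] with ω h₁
    by_cases hω : a ω = 0 <;> simp [h₁, hω]
  · refine key _ hc ⟨{c}, Set.countable_singleton c, ?_⟩
    filter_upwards [coeFn_indAE (μ := μ) _ ((g - algebraMap ℂ _ c).measurable
      (measurableSet_singleton 0)), AEEqFun.coeFn_sub g (algebraMap ℂ _ c),
      coeFn_algebraMap (μ := μ) c] with ω h₁ h₂ h₃
    by_cases hω : g ω = c <;> simp [h₁, h₂, h₃, hω, sub_eq_zero]

/-- A derivation can take any value at `g` that vanishes wherever `g` is countably valued. -/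
theorem exists_isDeriv_apply_eq [SFinite μ] {g u : Ω →ₘ[μ] ℂ}
    (hu : ∀ C : Set ℂ, C.Countable → ∀ᵐ ω ∂μ, g ω ∈ C → u ω = 0) :
    ∃ D : (Ω →ₘ[μ] ℂ) →ₗ[ℂ] (Ω →ₘ[μ] ℂ), IsDeriv D ∧ D g = u := by
  obtain ⟨d, hd⟩ := baer_aeEqFun.exists_derivation_apply_eq (k := ℂ) (x := g) (y := u) <| by
    intro a ha
    obtain ⟨C, hC, haC⟩ := ae_eq_zero_or_mem_countable_of_smul_D_eq_zero ha
    apply AEEqFun.ext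
    filter_upwards [haC, hu C hC, AEEqFun.coeFn_mul a u,
      AEEqFun.coeFn_zero (μ := μ) (β := ℂ)] with ω h₁ h₂ h₃ h₄
    rw [h₃, h₄, Pi.mul_apply]
    rcases h₁ with h₁ | h₁ <;> simp [h₁, h₂]
  exact ⟨d, d.isDeriv, hd⟩

theorem IsDeriv.isLocalDeriv_comp_self [SFinite μ] {D : (Ω →ₘ[μ] ℂ) →ₗ[ℂ] (Ω →ₘ[μ] ℂ)}
    (hD : IsDeriv D) : IsLocalDeriv (D ∘ₗ D) := fun f => by
  obtain ⟨D', hD', h⟩ := exists_isDeriv_apply_eq fun C hC => hD.ae_apply_apply_eq_zero f hC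
  exact ⟨D', hD', h.symm⟩

theorem IsDeriv.not_isDeriv_comp_self {D : (Ω →ₘ[μ] ℂ) →ₗ[ℂ] (Ω →ₘ[μ] ℂ)}
    (hD : IsDeriv D) (h₀ : D ≠ 0) : ¬ IsDeriv (D ∘ₗ D) := by
  intro h
  refine h₀ (LinearMap.ext fun f => ?_)
  have h₁ := h f f
  simp only [LinearMap.comp_apply, hD f f, map_add, hD (D f) f, hD f (D f)] at h₁
  have h₂ : (2 : ℂ) • (D f * D f) = 0 := by
    rw [two_smul]
    linear_combination h₁
  have h₃ := (smul_eq_zero_iff_right (two_ne_zero' ℂ)).mp h₂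
  apply AEEqFun.ext
  filter_upwards [AEEqFun.coeFn_mul (D f) (D f),
    AEEqFun.coeFn_zero (μ := μ) (β := ℂ)] with ω h₄ h₅
  rw [h₃, h₅] at h₄
  rw [LinearMap.zero_apply, h₅]
  simpa using h₄.symm

theorem exists_isDeriv_ne_zero [SFinite μ] {g : Ω →ₘ[μ] ℂ} (hg : ¬ CountablyValued g) :
    ∃ D : (Ω →ₘ[μ] ℂ) →ₗ[ℂ] (Ω →ₘ[μ] ℂ), IsDeriv D ∧ D ≠ 0 := by
  let C₀ : Set ℂ := {c | 0 < μ {ω | g ω = c}}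
  have hC₀ : C₀.Countable := Measure.countable_meas_level_set_pos g.measurable
  have hm : MeasurableSet (g ⁻¹' C₀ᶜ) := g.measurable hC₀.measurableSet.compl
  obtain ⟨D, hD, hDg⟩ := exists_isDeriv_apply_eq (g := g) (u := indAE μ (g ⁻¹' C₀ᶜ) hm) <| by
    intro C hC
    have h : ∀ᵐ ω ∂μ, ∀ c ∈ C \ C₀, g ω ≠ c :=
      (ae_ball_iff (hC.mono Set.sdiff_subset)).mpr fun c hc => by
        have h₀ : μ {ω | g ω = c} = 0 := by simpa [C₀] using hc.2
        simpa [ae_iff] using h₀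
    filter_upwards [h, coeFn_indAE (μ := μ) (g ⁻¹' C₀ᶜ) hm] with ω h₁ h₂ hω
    rw [h₂, Set.indicator_of_notMem]
    exact fun hω' => h₁ _ ⟨hω, hω'⟩ rfl
  refine ⟨D, hD, ?_⟩
  rintro rfl
  refine hg ⟨C₀, hC₀, ?_⟩
  rw [LinearMap.zero_apply] at hDg
  filter_upwards [coeFn_indAE (μ := μ) (g ⁻¹' C₀ᶜ) hm,
    hDg ▸ AEEqFun.coeFn_zero (μ := μ) (β := ℂ)] with ω h₁ h₂
  by_contra hω
  rw [h₂, Set.indicator_of_mem (by exact hω)] at h₁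
  simp at h₁

end L0

/-- Theorem 3.5 for L⁰: for a finite measure space (Ω,Σ,μ),
the following are equivalent: (i) K_c ≠ L⁰; (ii) L⁰ admits a non-zero
derivation; (iii) L⁰ admits a non-zero local derivation; (iv) L⁰ admits a
local derivation which is not a derivation. -/
theorem L0_localDerivation_tfae
    {Ω : Type*} [MeasurableSpace Ω] (μ : Measure Ω) [IsFiniteMeasure μ] :
    List.TFAE
      [¬ (∀ f : Ω →ₘ[μ] ℂ, CountablyValued f),
       ∃ D : (Ω →ₘ[μ] ℂ) →ₗ[ℂ] (Ω →ₘ[μ] ℂ), IsDeriv D ∧ D ≠ 0,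
       ∃ Δ : (Ω →ₘ[μ] ℂ) →ₗ[ℂ] (Ω →ₘ[μ] ℂ), IsLocalDeriv Δ ∧ Δ ≠ 0,
       ∃ Δ : (Ω →ₘ[μ] ℂ) →ₗ[ℂ] (Ω →ₘ[μ] ℂ), IsLocalDeriv Δ ∧ ¬ IsDeriv Δ] := by
  tfae_have 1 → 2 := fun h => by
    obtain ⟨g, hg⟩ := not_forall.mp h
    exact exists_isDeriv_ne_zero hg
  tfae_have 2 → 4 := fun ⟨D, hD, h₀⟩ =>
    ⟨D ∘ₗ D, hD.isLocalDeriv_comp_self, hD.not_isDeriv_comp_self h₀⟩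
  tfae_have 4 → 3 := fun ⟨Δ, hΔ, h⟩ =>
    ⟨Δ, hΔ, fun h₀ => h (by simp [h₀, IsDeriv])⟩
  tfae_have 3 → 1 := fun ⟨Δ, hΔ, h₀⟩ h => h₀ <| LinearMap.ext fun f => by
    obtain ⟨D, hD, hf⟩ := hΔ f
    obtain ⟨C, hC, hfC⟩ := h f
    rw [hf, LinearMap.zero_apply]
    apply AEEqFun.ext
    filter_upwards [hD.ae_apply_eq_zero f hC, hfC, AEEqFun.coeFn_zero (μ := μ) (β := ℂ)]
      with ω h₁ h₂ h₃
    rw [h₁ h₂, h₃, Pi.zero_apply]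
  tfae_finish
end

section
/- Let (Ω,Σ,μ) be a finite measure space and L⁰ = L⁰(Ω,Σ,μ) the algebra of equivalence classes of measurable complex functions on Ω. If D is a non-zero derivation on L⁰, then the map Δ = D ∘ D is a local derivation on L⁰ which is not a derivation. -/
open MeasureTheory

namespace IsDeriv

variable {Ω : Type*} [MeasurableSpace Ω] {μ : Measure Ω}

/-- `L⁰` is von Neumann regular: every element has a quasi-inverse. -/
theorem exists_mul_mul_eq_self (b : Ω →ₘ[μ] ℂ) : ∃ c : Ω →ₘ[μ] ℂ, b * c * b = b := by
  refine ⟨AEEqFun.compMeasurable _ measurable_inv b, ?_⟩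
  refine AEEqFun.ext ?_
  filter_upwards [AEEqFun.coeFn_mul (b * AEEqFun.compMeasurable _ measurable_inv b) b,
    AEEqFun.coeFn_mul b (AEEqFun.compMeasurable _ measurable_inv b),
    AEEqFun.coeFn_compMeasurable _ measurable_inv b] with ω h₁ h₂ h₃
  refine h₁.trans ?_
  rw [Pi.mul_apply, h₂, Pi.mul_apply, h₃]
  exact mul_inv_mul_cancel (b ω)

/-- `L⁰` is reduced. -/
theorem eq_zero_of_mul_self_eq_zero {b : Ω →ₘ[μ] ℂ} (h : b * b = 0) : b = 0 := by
  obtain ⟨c, hc⟩ := exists_mul_mul_eq_self b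
  linear_combination c * h - hc

variable {D : (Ω →ₘ[μ] ℂ) →ₗ[ℂ] (Ω →ₘ[μ] ℂ)}

/-- Derivations vanish on idempotents. -/
theorem map_idempotent (hD : IsDeriv D) {e : Ω →ₘ[μ] ℂ} (he : e * e = e) : D e = 0 := by
  have h := hD e e
  rw [he] at h
  linear_combination (1 - 2 * e) * h - 4 * D e * he

/-- The multiple `a D` of a linear map `D` on `L⁰` by an element `a` of `L⁰`. -/
noncomputable def leftMul (a : Ω →ₘ[μ] ℂ) (D : (Ω →ₘ[μ] ℂ) →ₗ[ℂ] (Ω →ₘ[μ] ℂ)) :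
    (Ω →ₘ[μ] ℂ) →ₗ[ℂ] (Ω →ₘ[μ] ℂ) where
  toFun f := a * D f
  map_add' f g := by rw [map_add, mul_add]
  map_smul' c f := by
    rw [map_smul]
    refine AEEqFun.toGerm_injective ?_
    simp only [AEEqFun.mul_toGerm, AEEqFun.smul_toGerm, RingHom.id_apply]
    induction a.toGerm, (D f).toGerm using Filter.Germ.inductionOn₂ with
    | _ u v => exact congrArg _ (mul_smul_comm c u v)

theorem leftMul_isDeriv (hD : IsDeriv D) (a : Ω →ₘ[μ] ℂ) : IsDeriv (leftMul a D) := by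
  intro f g
  change a * D (f * g) = a * D f * g + f * (a * D g)
  rw [hD f g]
  ring

/-- Every derivation maps each element to a multiple of that element. -/
theorem exists_map_eq_mul (hD : IsDeriv D) (b : Ω →ₘ[μ] ℂ) :
    ∃ a : Ω →ₘ[μ] ℂ, D b = a * b := by
  obtain ⟨c, hc⟩ := exists_mul_mul_eq_self b
  have he : D (b * c) = 0 := hD.map_idempotent (by linear_combination c * hc)
  have h := hD (b * c) b
  rw [hc, he] at h
  exact ⟨c * D b, by linear_combination h⟩

end IsDeriv

/-- if D is a non-zero derivation on L⁰(Ω,Σ,μ) (μ a finite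
measure), then Δ = D ∘ D is a local derivation which is not a derivation. -/
theorem square_of_nonzero_derivation_is_strict_local_derivation
    {Ω : Type*} [MeasurableSpace Ω] (μ : Measure Ω) [IsFiniteMeasure μ]
    (D : (Ω →ₘ[μ] ℂ) →ₗ[ℂ] (Ω →ₘ[μ] ℂ)) (hD : IsDeriv D) (hD0 : D ≠ 0) :
    IsLocalDeriv (D ∘ₗ D) ∧ ¬ IsDeriv (D ∘ₗ D) := by
  constructor
  · intro f
    obtain ⟨a, ha⟩ := hD.exists_map_eq_mul (D f)
    exact ⟨IsDeriv.leftMul a D, hD.leftMul_isDeriv a, ha⟩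
  · intro h
    refine hD0 (LinearMap.ext fun f => IsDeriv.eq_zero_of_mul_self_eq_zero ?_)
    have h₁ := h f f
    simp only [LinearMap.comp_apply] at h₁
    rw [hD f f, map_add, hD (D f) f, hD f (D f)] at h₁
    have h₂ : D f * D f + D f * D f = 0 := by linear_combination h₁
    rw [← two_smul ℂ] at h₂
    exact (smul_eq_zero.mp h₂).resolve_left two_ne_zero
end
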